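/- arXiv:2405.20769 — 2 statements merged into one kernel-verified Lean document; each statement's English description precedes it below -/
import Mathlib

section
/- Dominating pairs dominate self-composition: let D be an arbitrary type equipped with a binary relation ∼, let M assign to each element of D a probability measure M(d) on a measurable space Ω, and let P, Q be probability measures such that H_α(M(d) ‖ M(d')) ≤ H_α(P ‖ Q) for all d ∼ d' and all α ≥ 0. Then for every integer k ≥ 1, all d ∼ d', and all α ≥ 0, H_α(M(d)^{⊗k} ‖ M(d')^{⊗k}) ≤ H_α(P^{⊗k} ‖ Q^{⊗k}), where μ^{⊗k} denotes the k-fold product measure of μ with itself. -/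
open MeasureTheory ProbabilityTheory

/-- Hockey-stick divergence: `H_α(P ‖ Q) = sup_{E measurable} (P(E) − α·Q(E))`. -/
noncomputable def hsDiv {X : Type*} [MeasurableSpace X] (α : ℝ) (P Q : Measure X) : ℝ :=
  ⨆ E : {E : Set X // MeasurableSet E}, ((P E).toReal - α * (Q E).toReal)

section HockeyStick

variable {X X' Y : Type*} [MeasurableSpace X] [MeasurableSpace X'] [MeasurableSpace Y]

theorem le_hsDiv (P Q : Measure X) [IsFiniteMeasure P] {α : ℝ} (hα : 0 ≤ α)
    {E : Set X} (hE : MeasurableSet E) : P.real E - α * Q.real E ≤ hsDiv α P Q := by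
  refine le_ciSup (f := fun E : {E : Set X // MeasurableSet E} ↦
    (P E).toReal - α * (Q E).toReal) ⟨P.real Set.univ, ?_⟩ ⟨E, hE⟩
  rintro _ ⟨F, rfl⟩
  have h₁ : P.real F ≤ P.real Set.univ := measureReal_mono (Set.subset_univ _)
  have h₂ : 0 ≤ α * Q.real F := by positivity
  simp only [← measureReal_def]
  linarith

theorem hsDiv_le {P Q : Measure X} {α c : ℝ}
    (h : ∀ E, MeasurableSet E → P.real E - α * Q.real E ≤ c) : hsDiv α P Q ≤ c :=
  have : Nonempty {E : Set X // MeasurableSet E} := ⟨⟨∅, .empty⟩⟩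
  ciSup_le fun E ↦ h E E.2

theorem hsDiv_map_le (P Q : Measure X) [IsFiniteMeasure P] {f : X → Y}
    (hf : Measurable f) {α : ℝ} (hα : 0 ≤ α) :
    hsDiv α (P.map f) (Q.map f) ≤ hsDiv α P Q := by
  refine hsDiv_le fun E hE ↦ ?_
  rw [map_measureReal_apply hf hE, map_measureReal_apply hf hE]
  exact le_hsDiv P Q hα (hf hE)

theorem hsDiv_map_measurableEquiv (P Q : Measure X) [IsFiniteMeasure P] (e : X ≃ᵐ Y)
    {α : ℝ} (hα : 0 ≤ α) : hsDiv α (P.map e) (Q.map e) = hsDiv α P Q := by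
  refine le_antisymm (hsDiv_map_le P Q e.measurable hα) ?_
  simpa using hsDiv_map_le (P.map e) (Q.map e) e.symm.measurable hα

theorem hsDiv_prod_swap (μ ν : Measure X) (P Q : Measure Y) [IsFiniteMeasure μ]
    [IsFiniteMeasure ν] [IsFiniteMeasure P] [IsFiniteMeasure Q] {α : ℝ} (hα : 0 ≤ α) :
    hsDiv α (P.prod μ) (Q.prod ν) = hsDiv α (μ.prod P) (ν.prod Q) := by
  rw [← hsDiv_map_measurableEquiv (μ.prod P) (ν.prod Q) MeasurableEquiv.prodComm hα]
  exact (congrArg₂ (hsDiv α) Measure.prod_swap Measure.prod_swap).symm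

/-- The likelihood-ratio set on which `a * P - b * Q` is nonnegative. -/
def likelihoodSet (P Q : Measure X) (a b : ℝ) : Set X :=
  {x | 0 ≤ a * (P.rnDeriv (P + Q) x).toReal - b * (Q.rnDeriv (P + Q) x).toReal}

theorem le_likelihoodSet (P Q : Measure X) [IsFiniteMeasure P] [IsFiniteMeasure Q] (a b : ℝ)
    {E : Set X} (hE : MeasurableSet E) :
    a * P.real E - b * Q.real E ≤
      a * P.real (likelihoodSet P Q a b) - b * Q.real (likelihoodSet P Q a b) := by
  have hP : P ≪ P + Q := Measure.absolutelyContinuous_of_le (Measure.le_add_right le_rfl)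
  have hQ : Q ≪ P + Q := Measure.absolutelyContinuous_of_le (Measure.le_add_left le_rfl)
  have iP : Integrable (fun x ↦ a * (P.rnDeriv (P + Q) x).toReal) (P + Q) :=
    Measure.integrable_toReal_rnDeriv.const_mul a
  have iQ : Integrable (fun x ↦ b * (Q.rnDeriv (P + Q) x).toReal) (P + Q) :=
    Measure.integrable_toReal_rnDeriv.const_mul b
  have key (F : Set X) : ∫ x in F, (a * (P.rnDeriv (P + Q) x).toReal
      - b * (Q.rnDeriv (P + Q) x).toReal) ∂(P + Q) = a * P.real F - b * Q.real F := by
    rw [integral_sub iP.integrableOn iQ.integrableOn, integral_const_mul, integral_const_mul,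
      Measure.setIntegral_toReal_rnDeriv hP, Measure.setIntegral_toReal_rnDeriv hQ]
  rw [← key, ← key]
  exact setIntegral_le_nonneg hE (by fun_prop) (iP.sub iQ)

/-- Homogeneous form of domination: every test against the dominated pair, with arbitrary
nonnegative weights, is matched by the likelihood-ratio set of the dominating pair. -/
theorem le_likelihoodSet_of_hsDiv_le {P₁ Q₁ : Measure X'} {P Q : Measure X}
    [IsFiniteMeasure P₁] [IsFiniteMeasure P] [IsFiniteMeasure Q]
    (h : ∀ α, 0 ≤ α → hsDiv α P₁ Q₁ ≤ hsDiv α P Q) {a b : ℝ} (ha : 0 ≤ a) (hb : 0 ≤ b)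
    {E : Set X'} (hE : MeasurableSet E) :
    a * P₁.real E - b * Q₁.real E ≤
      a * P.real (likelihoodSet P Q a b) - b * Q.real (likelihoodSet P Q a b) := by
  rcases ha.eq_or_lt with rfl | ha
  · have h₁ := le_likelihoodSet P Q 0 b .empty
    have h₂ : 0 ≤ b * Q₁.real E := by positivity
    simp only [measureReal_empty] at h₁
    linarith
  · have hba : 0 ≤ b / a := by positivity
    have h₁ := (le_hsDiv P₁ Q₁ hba hE).trans <| (h _ hba).trans <|
      hsDiv_le (c := (a * P.real (likelihoodSet P Q a b)
        - b * Q.real (likelihoodSet P Q a b)) / a) fun F hF ↦ by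
          rw [le_div_iff₀ ha]
          refine le_of_eq_of_le ?_ (le_likelihoodSet P Q a b hF)
          field_simp
    rw [le_div_iff₀ ha] at h₁
    refine le_of_eq_of_le ?_ h₁
    field_simp

theorem measureReal_prod_eq_integral_rnDeriv (μ ξ : Measure Y) (P : Measure X)
    [IsFiniteMeasure μ] [IsFiniteMeasure ξ] [IsFiniteMeasure P] (hμ : μ ≪ ξ)
    {E : Set (Y × X)} (hE : MeasurableSet E) :
    Integrable (fun y ↦ (μ.rnDeriv ξ y).toReal * P.real (Prod.mk y ⁻¹' E)) ξ ∧
      (μ.prod P).real E = ∫ y, (μ.rnDeriv ξ y).toReal * P.real (Prod.mk y ⁻¹' E) ∂ξ := by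
  have hi : Integrable (fun y ↦ P.real (Prod.mk y ⁻¹' E)) μ :=
    Measure.integrable_measure_prodMk_left hE (measure_ne_top _ _)
  refine ⟨(integrable_rnDeriv_smul_iff hμ).2 hi, ?_⟩
  refine Eq.trans ?_ (integral_rnDeriv_smul hμ).symm
  rw [measureReal_def, Measure.prod_apply hE]
  exact (integral_toReal (measurable_measure_prodMk_left hE).aemeasurable
    (.of_forall fun _ ↦ measure_lt_top _ _)).symm

theorem hsDiv_prod_le_of_hsDiv_le (μ ν : Measure Y) {P₁ Q₁ : Measure X'} {P Q : Measure X}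
    [IsFiniteMeasure μ] [IsFiniteMeasure ν] [IsFiniteMeasure P₁] [IsFiniteMeasure Q₁]
    [IsFiniteMeasure P] [IsFiniteMeasure Q]
    (h : ∀ α, 0 ≤ α → hsDiv α P₁ Q₁ ≤ hsDiv α P Q) {α : ℝ} (hα : 0 ≤ α) :
    hsDiv α (μ.prod P₁) (ν.prod Q₁) ≤ hsDiv α (μ.prod P) (ν.prod Q) := by
  refine hsDiv_le fun E hE ↦ ?_
  have hμ : μ ≪ μ + ν := Measure.absolutelyContinuous_of_le (Measure.le_add_right le_rfl)
  have hν : ν ≪ μ + ν := Measure.absolutelyContinuous_of_le (Measure.le_add_left le_rfl)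
  set f := fun y ↦ (μ.rnDeriv (μ + ν) y).toReal
  set g := fun y ↦ (ν.rnDeriv (μ + ν) y).toReal
  let F : Set (Y × X) := {z | z.2 ∈ likelihoodSet P Q (f z.1) (α * g z.1)}
  have hF : MeasurableSet F := by
    refine measurableSet_le (f := fun _ ↦ (0 : ℝ)) (g := fun z : Y × X ↦
      f z.1 * (P.rnDeriv (P + Q) z.2).toReal - α * g z.1 * (Q.rnDeriv (P + Q) z.2).toReal)
      measurable_const (by fun_prop)
  refine le_trans ?_ (le_hsDiv _ _ hα hF)
  obtain ⟨i₁, e₁⟩ := measureReal_prod_eq_integral_rnDeriv μ _ P₁ hμ hE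
  obtain ⟨i₂, e₂⟩ := measureReal_prod_eq_integral_rnDeriv ν _ Q₁ hν hE
  obtain ⟨i₃, e₃⟩ := measureReal_prod_eq_integral_rnDeriv μ _ P hμ hF
  obtain ⟨i₄, e₄⟩ := measureReal_prod_eq_integral_rnDeriv ν _ Q hν hF
  rw [e₁, e₂, e₃, e₄, ← integral_const_mul, ← integral_const_mul,
    ← integral_sub i₁ (i₂.const_mul α), ← integral_sub i₃ (i₄.const_mul α)]
  refine integral_mono (i₁.sub (i₂.const_mul α)) (i₃.sub (i₄.const_mul α)) fun y ↦ ?_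
  have := le_likelihoodSet_of_hsDiv_le h (a := f y) (b := α * g y)
    ENNReal.toReal_nonneg (mul_nonneg hα ENNReal.toReal_nonneg) (measurable_prodMk_left (x := y) hE)
  simp only [← mul_assoc]
  exact this

theorem hsDiv_pi_succ (P Q : Measure X) [IsFiniteMeasure P] [IsFiniteMeasure Q] (n : ℕ)
    {α : ℝ} (hα : 0 ≤ α) :
    hsDiv α (Measure.pi fun _ : Fin (n + 1) ↦ P) (Measure.pi fun _ : Fin (n + 1) ↦ Q) =
      hsDiv α (P.prod (Measure.pi fun _ : Fin n ↦ P)) (Q.prod (Measure.pi fun _ : Fin n ↦ Q)) := by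
  rw [← hsDiv_map_measurableEquiv _ _ (MeasurableEquiv.piFinSuccAbove (fun _ ↦ X) 0) hα,
    (measurePreserving_piFinSuccAbove (fun _ : Fin (n + 1) ↦ P) 0).map_eq,
    (measurePreserving_piFinSuccAbove (fun _ : Fin (n + 1) ↦ Q) 0).map_eq]

theorem hsDiv_pi_le_of_hsDiv_le {P₁ Q₁ : Measure X'} {P Q : Measure X}
    [IsFiniteMeasure P₁] [IsFiniteMeasure Q₁] [IsFiniteMeasure P] [IsFiniteMeasure Q]
    (h : ∀ α, 0 ≤ α → hsDiv α P₁ Q₁ ≤ hsDiv α P Q) (n : ℕ) :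
    ∀ α, 0 ≤ α →
      hsDiv α (Measure.pi fun _ : Fin n ↦ P₁) (Measure.pi fun _ : Fin n ↦ Q₁) ≤
        hsDiv α (Measure.pi fun _ : Fin n ↦ P) (Measure.pi fun _ : Fin n ↦ Q) := by
  induction n with
  | zero =>
    intro α hα
    rw [Measure.pi_of_empty, Measure.pi_of_empty, Measure.pi_of_empty, Measure.pi_of_empty]
    refine hsDiv_le fun E hE ↦ ?_
    refine le_trans ?_ (le_hsDiv _ _ hα (E := {_x | isEmptyElim ∈ E}) (.const _))
    simp only [measureReal_def, Measure.dirac_apply' _ hE, Measure.dirac_apply' _ (.const _)]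
    rfl
  | succ n ih =>
    intro α hα
    rw [hsDiv_pi_succ _ _ _ hα, hsDiv_pi_succ _ _ _ hα]
    refine (hsDiv_prod_le_of_hsDiv_le P₁ Q₁ ih hα).trans ?_
    rw [← hsDiv_prod_swap _ _ _ _ hα, ← hsDiv_prod_swap P Q _ _ hα]
    exact hsDiv_prod_le_of_hsDiv_le _ _ h hα

end HockeyStick

/-- Dominating pairs dominate self-composition: if `(P, Q)` is a dominating pair of
distributions for the mechanism `M` under the neighboring relation `Neighbor`, then
for every `k ≥ 1` the `k`-fold product pair `(P^⊗k, Q^⊗k)` dominates the `k`-fold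
self-composition of `M`. -/
theorem hsDiv_pi_le_of_dominating_pair
    {D : Type*} {Ω : Type*} [MeasurableSpace Ω]
    (Neighbor : D → D → Prop) (M : D → Measure Ω)
    (hM : ∀ d, IsProbabilityMeasure (M d))
    (P Q : Measure Ω) [IsProbabilityMeasure P] [IsProbabilityMeasure Q]
    (hdom : ∀ d d', Neighbor d d' → ∀ α : ℝ, 0 ≤ α → hsDiv α (M d) (M d') ≤ hsDiv α P Q)
    (k : ℕ) (hk : 1 ≤ k) (d d' : D) (hdd' : Neighbor d d') (α : ℝ) (hα : 0 ≤ α) :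
    hsDiv α (Measure.pi fun _ : Fin k => M d) (Measure.pi fun _ : Fin k => M d')
      ≤ hsDiv α (Measure.pi fun _ : Fin k => P) (Measure.pi fun _ : Fin k => Q) := by
  have := hM d
  have := hM d'
  exact hsDiv_pi_le_of_hsDiv_le (hdom d d' hdd') k α hα
end

section
/- Dominating pair of datasets for the Poisson-subsampled Laplace mechanism under the add relation: let s > 0 and γ ∈ [0,1]. For every pair of finite tuples D, D' with all entries in [−1,1] such that D' is obtained from D by inserting one additional entry, and every α ≥ 0, H_α(Lγ(D) ‖ Lγ(D')) ≤ H_α(Lap(0,s) ‖ (1−γ)·Lap(0,s) + γ·Lap(1,s)). Moreover this bound is realized: for D = (0,…,0) and D' = (0,…,0,1), Lγ(D) = Lap(0,s) and Lγ(D') = (1−γ)·Lap(0,s) + γ·Lap(1,s). -/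
open MeasureTheory ProbabilityTheory
open scoped ENNReal NNReal

/-- The Laplace distribution `Lap(μ, s)` with density `x ↦ exp(−|x−μ|/s)/(2s)`. -/
noncomputable def lap (μ s : ℝ) : Measure ℝ :=
  volume.withDensity fun x => ENNReal.ofReal ((1 / (2 * s)) * Real.exp (-|x - μ| / s))

/-- The Poisson-subsampled Laplace mechanism:
`Lγ(x) = ∑_{S ⊆ [m]} γ^{|S|} (1−γ)^{m−|S|} · Lap(∑_{i∈S} x_i, s)`. -/
noncomputable def poissonLap (s γ : ℝ) {m : ℕ} (x : Fin m → ℝ) : Measure ℝ :=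
  ∑ S : Finset (Fin m),
    ENNReal.ofReal (γ ^ S.card * (1 - γ) ^ (m - S.card)) • lap (∑ i ∈ S, x i) s

lemma integrable_lap_density (μ : ℝ) {s : ℝ} (hs : 0 < s) :
    Integrable fun x : ℝ => (1 / (2 * s)) * Real.exp (-|x - μ| / s) := by
  suffices h : Integrable fun x : ℝ => Real.exp (-|x| / s) from
    (h.comp_sub_right μ).const_mul _
  rw [← integrableOn_univ, ← Set.Iic_union_Ioi (a := (0 : ℝ))]
  refine IntegrableOn.union ?_ ?_
  · refine (integrableOn_exp_mul_Iic (inv_pos.2 hs) 0).congr_fun (fun x hx => ?_)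
      measurableSet_Iic
    simp only [abs_of_nonpos (Set.mem_Iic.1 hx), neg_neg, div_eq_inv_mul]
  · refine (integrableOn_exp_mul_Ioi (neg_lt_zero.2 (inv_pos.2 hs)) 0).congr_fun
      (fun x hx => ?_) measurableSet_Ioi
    simp only [abs_of_pos (Set.mem_Ioi.1 hx), div_eq_inv_mul, mul_neg, neg_mul]

lemma isFiniteMeasure_lap (μ : ℝ) {s : ℝ} (hs : 0 < s) : IsFiniteMeasure (lap μ s) :=
  isFiniteMeasure_withDensity_ofReal (integrable_lap_density μ hs).2

lemma lap_real_apply (μ : ℝ) {s : ℝ} (hs : 0 < s) {E : Set ℝ} (hE : MeasurableSet E) :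
    (lap μ s).real E = ∫ x in E, (1 / (2 * s)) * Real.exp (-|x - μ| / s) := by
  rw [measureReal_def, lap, withDensity_apply _ hE,
    integral_eq_lintegral_of_nonneg_ae (ae_of_all _ fun x => by positivity)
      (integrable_lap_density μ hs).aestronglyMeasurable.restrict]

lemma lap_real_preimage (s : ℝ) {μ ν : ℝ} {g : ℝ → ℝ} (hg : MeasurePreserving g)
    (h : ∀ x, |g x - ν| = |x - μ|) {E : Set ℝ} (hE : MeasurableSet E) :
    (lap μ s).real (g ⁻¹' E) = (lap ν s).real E := by
  rw [measureReal_def, measureReal_def, lap, lap, withDensity_apply _ (hg.measurable hE),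
    withDensity_apply _ hE, ← hg.setLIntegral_comp_preimage hE (by fun_prop)]
  simp only [h]

lemma lap_real_preimage_add_right (s μ a : ℝ) {E : Set ℝ} (hE : MeasurableSet E) :
    (lap μ s).real ((· + a) ⁻¹' E) = (lap (μ + a) s).real E :=
  lap_real_preimage s (measurePreserving_add_right volume a)
    (fun x => by rw [add_sub_add_right_eq_sub]) hE

lemma lap_real_preimage_neg (s μ : ℝ) {E : Set ℝ} (hE : MeasurableSet E) :
    (lap μ s).real (Neg.neg ⁻¹' E) = (lap (-μ) s).real E :=
  lap_real_preimage s (Measure.measurePreserving_neg volume)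
    (fun x => by rw [← abs_neg, neg_sub_neg, neg_sub, abs_sub_comm, abs_sub_comm]) hE

/-- Among lower sets, Laplace measure decreases as the location increases. -/
lemma lap_real_antitone_of_isLowerSet {s : ℝ} (hs : 0 < s) {A : Set ℝ} (hA : IsLowerSet A)
    (hAm : MeasurableSet A) {μ ν : ℝ} (h : μ ≤ ν) : (lap ν s).real A ≤ (lap μ s).real A := by
  have := isFiniteMeasure_lap 0 hs
  rw [← zero_add ν, ← zero_add μ, ← lap_real_preimage_add_right s 0 ν hAm,
    ← lap_real_preimage_add_right s 0 μ hAm]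
  exact measureReal_mono fun x hx => hA (by simpa using h) hx

/-- The Laplace family has monotone likelihood ratio. -/
lemma lap_density_mul_le {s : ℝ} (hs : 0 < s) {v x y : ℝ} (hv : 0 ≤ v) (hyx : y ≤ x) :
    ((1 / (2 * s)) * Real.exp (-|x - 0| / s)) * ((1 / (2 * s)) * Real.exp (-|y - v| / s)) ≤
      ((1 / (2 * s)) * Real.exp (-|y - 0| / s)) * ((1 / (2 * s)) * Real.exp (-|x - v| / s)) := by
  rw [mul_mul_mul_comm, mul_mul_mul_comm _ (Real.exp (-|y - 0| / s)), ← Real.exp_add,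
    ← Real.exp_add, ← add_div, ← add_div]
  gcongr _ * Real.exp (?_ / s)
  simp only [sub_zero]
  grind

/-- A Neyman–Pearson set for `Lap(0, s)` against `Lap(v, s)` with `v ≥ 0` is a lower set. -/
lemma exists_isLowerSet_lap_le {s : ℝ} (hs : 0 < s) {v : ℝ} (hv : 0 ≤ v) {b : ℝ} (hb : 0 ≤ b)
    (c : ℝ) {E : Set ℝ} (hE : MeasurableSet E) :
    ∃ A : Set ℝ, IsLowerSet A ∧ MeasurableSet A ∧
      c * (lap 0 s).real E - b * (lap v s).real E ≤
        c * (lap 0 s).real A - b * (lap v s).real A := by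
  set p : ℝ → ℝ → ℝ := fun μ x => (1 / (2 * s)) * Real.exp (-|x - μ| / s) with hp
  have hpos : ∀ μ x, 0 < p μ x := fun μ x => by positivity
  have hint : ∀ μ, Integrable (p μ) := fun μ => integrable_lap_density μ hs
  set f : ℝ → ℝ := fun x => c * p 0 x - b * p v x with hf
  have hfint : Integrable f := ((hint 0).const_mul c).sub ((hint v).const_mul b)
  have hfm : Measurable f := by fun_prop
  have hA : MeasurableSet {x | 0 < f x} := measurableSet_lt measurable_const hfm
  have key : ∀ {S : Set ℝ}, MeasurableSet S →
      c * (lap 0 s).real S - b * (lap v s).real S = ∫ x in S, f x := by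
    intro S hS
    rw [lap_real_apply 0 hs hS, lap_real_apply v hs hS, ← integral_const_mul,
      ← integral_const_mul, ← integral_sub ((hint 0).const_mul c).integrableOn
        ((hint v).const_mul b).integrableOn]
  refine ⟨{x | 0 < f x}, fun x y hyx hx => ?_, hA, ?_⟩
  · have hx' : b * p v x < c * p 0 x := sub_pos.1 hx
    have hc : 0 < c := by
      refine pos_of_mul_pos_left ?_ (hpos 0 x).le
      exact (mul_nonneg hb (hpos v x).le).trans_lt hx'
    refine sub_pos.2 (lt_of_mul_lt_mul_right ?_ (hpos v x).le)
    calc b * p v y * p v x = b * p v x * p v y := by ring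
      _ < c * p 0 x * p v y := mul_lt_mul_of_pos_right hx' (hpos v y)
      _ = c * (p 0 x * p v y) := by ring
      _ ≤ c * (p 0 y * p v x) :=
          mul_le_mul_of_nonneg_left (lap_density_mul_le hs hv hyx) hc.le
      _ = c * p 0 y * p v x := by ring
  · rw [key hE, key hA, ← integral_indicator hE, ← integral_indicator hA]
    refine integral_mono (hfint.indicator hE) (hfint.indicator hA) fun x => ?_
    by_cases h1 : x ∈ E <;> by_cases h2 : 0 < f x <;> simp [Set.indicator, h1, h2]
    · exact not_lt.1 h2
    · exact h2.le

lemma exists_lap_le_lap_one {s : ℝ} (hs : 0 < s) {v : ℝ} (hv : |v| ≤ 1) {b : ℝ} (hb : 0 ≤ b)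
    (c : ℝ) {E : Set ℝ} (hE : MeasurableSet E) :
    ∃ A : Set ℝ, MeasurableSet A ∧
      c * (lap 0 s).real E - b * (lap v s).real E ≤
        c * (lap 0 s).real A - b * (lap 1 s).real A := by
  wlog hv0 : 0 ≤ v generalizing v E
  · have := this (v := -v) (by rwa [abs_neg]) (measurable_neg hE) (by linarith)
    rwa [lap_real_preimage_neg s _ hE, lap_real_preimage_neg s _ hE, neg_neg, neg_zero] at this
  · obtain ⟨A, hAl, hA, h⟩ := exists_isLowerSet_lap_le hs hv0 hb c hE
    refine ⟨A, hA, h.trans (sub_le_sub_left (mul_le_mul_of_nonneg_left ?_ hb) _)⟩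
    exact lap_real_antitone_of_isLowerSet hs hAl hA (le_of_abs_le hv)

lemma sum_finset_fin_succAbove {M : Type*} [AddCommMonoid M] {m : ℕ} (i : Fin (m + 1))
    (f : Finset (Fin (m + 1)) → M) :
    ∑ S, f S = ∑ S : Finset (Fin m),
      (f (S.map i.succAboveEmb) + f (insert i (S.map i.succAboveEmb))) := by
  have hi : i ∉ (Finset.univ : Finset (Fin m)).image i.succAbove := by
    simp
  have hinj : Set.InjOn (fun S : Finset (Fin m) => S.image i.succAbove)
      (Finset.univ : Finset (Finset (Fin m))) :=
    (Finset.image_injective i.succAbove_right_injective).injOn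
  rw [← Finset.powerset_univ, Fin.univ_succAbove m i, Finset.cons_eq_insert,
    Finset.map_eq_image, Fin.coe_succAboveEmb, Finset.sum_powerset_insert hi,
    Finset.powerset_image, Finset.powerset_univ, Finset.sum_image hinj, Finset.sum_image hinj,
    ← Finset.sum_add_distrib]
  simp only [Finset.map_eq_image, Fin.coe_succAboveEmb]

/-- Conditioning the subsampled mechanism on whether the inserted entry is sampled. -/
lemma poissonLap_succAbove (s : ℝ) {γ : ℝ} (hγ0 : 0 ≤ γ) (hγ1 : γ ≤ 1) {m : ℕ}
    (i : Fin (m + 1)) {D : Fin m → ℝ} {D' : Fin (m + 1) → ℝ}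
    (hD : ∀ j, D j = D' (i.succAbove j)) :
    poissonLap s γ D' = ∑ S : Finset (Fin m),
      ENNReal.ofReal (γ ^ S.card * (1 - γ) ^ (m - S.card)) •
        (ENNReal.ofReal (1 - γ) • lap (∑ j ∈ S, D j) s +
          ENNReal.ofReal γ • lap (∑ j ∈ S, D j + D' i) s) := by
  have h1 : 0 ≤ 1 - γ := sub_nonneg.2 hγ1
  rw [poissonLap, sum_finset_fin_succAbove i]
  refine Finset.sum_congr rfl fun S _ => ?_
  have hi : i ∉ S.map i.succAboveEmb := by simp [Fin.succAbove_ne]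
  have hS : S.card ≤ m := by simpa using S.card_le_univ
  rw [Finset.card_insert_of_notMem hi, Finset.sum_insert hi, Finset.card_map, Finset.sum_map,
    smul_add, smul_smul, smul_smul, ← ENNReal.ofReal_mul (by positivity),
    ← ENNReal.ofReal_mul (by positivity), Nat.succ_sub hS, Nat.add_sub_add_right,
    pow_succ, pow_succ]
  simp only [Fin.coe_succAboveEmb, ← hD, add_comm (D' i)]
  congr 3 <;> ring_nf

lemma sum_poisson_weights (γ : ℝ) (m : ℕ) :
    ∑ S : Finset (Fin m), γ ^ S.card * (1 - γ) ^ (m - S.card) = 1 := by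
  rw [Fin.sum_pow_mul_eq_add_pow, add_sub_cancel, one_pow]

lemma sum_ofReal_poisson_weights {γ : ℝ} (hγ0 : 0 ≤ γ) (hγ1 : γ ≤ 1) (m : ℕ) :
    ∑ S : Finset (Fin m), ENNReal.ofReal (γ ^ S.card * (1 - γ) ^ (m - S.card)) = 1 := by
  have h1 : 0 ≤ 1 - γ := sub_nonneg.2 hγ1
  rw [← ENNReal.ofReal_sum_of_nonneg fun S _ => by positivity, sum_poisson_weights,
    ENNReal.ofReal_one]

lemma bddAbove_hsDiv {X : Type*} [MeasurableSpace X] {α : ℝ} (hα : 0 ≤ α) (P Q : Measure X)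
    [IsFiniteMeasure P] :
    BddAbove (Set.range fun E : {E : Set X // MeasurableSet E} =>
      (P E).toReal - α * (Q E).toReal) := by
  refine ⟨P.real Set.univ, ?_⟩
  rintro _ ⟨E, rfl⟩
  exact (sub_le_self _ (mul_nonneg hα ENNReal.toReal_nonneg)).trans
    (measureReal_mono (Set.subset_univ E.1))

lemma lap_sub_mixture_le_hsDiv {s γ : ℝ} (hs : 0 < s) (hγ0 : 0 ≤ γ) (hγ1 : γ ≤ 1) {α : ℝ}
    (hα : 0 ≤ α) (μ : ℝ) {v : ℝ} (hv : |v| ≤ 1) {E : Set ℝ} (hE : MeasurableSet E) :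
    (lap μ s).real E - α * ((1 - γ) * (lap μ s).real E + γ * (lap (μ + v) s).real E) ≤
      hsDiv α (lap 0 s) (ENNReal.ofReal (1 - γ) • lap 0 s + ENNReal.ofReal γ • lap 1 s) := by
  have := isFiniteMeasure_lap 0 hs
  have := isFiniteMeasure_lap 1 hs
  obtain ⟨A, hA, h⟩ := exists_lap_le_lap_one hs hv (mul_nonneg hα hγ0) (1 - α * (1 - γ))
    (measurable_add_const μ hE)
  rw [lap_real_preimage_add_right s _ _ hE, lap_real_preimage_add_right s _ _ hE, zero_add,
    add_comm v] at h
  refine le_trans ?_ (le_ciSup (bddAbove_hsDiv hα (lap 0 s) _) ⟨A, hA⟩)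
  simp only [← measureReal_def]
  rw [measureReal_add_apply (ENNReal.mul_ne_top ENNReal.ofReal_ne_top (measure_ne_top _ _))
    (ENNReal.mul_ne_top ENNReal.ofReal_ne_top (measure_ne_top _ _)),
    measureReal_ennreal_smul_apply, measureReal_ennreal_smul_apply,
    ENNReal.toReal_ofReal hγ0, ENNReal.toReal_ofReal (sub_nonneg.2 hγ1)]
  linarith

/-- Dominating pair of datasets for the Poisson-subsampled Laplace mechanism under the add
relation: for datasets with entries in `[−1,1]` where `D'` is `D` with one entry inserted,
`H_α(Lγ(D) ‖ Lγ(D')) ≤ H_α(Lap(0,s) ‖ (1−γ)Lap(0,s) + γLap(1,s))` for all `α ≥ 0`, and the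
bound is realized by `D = (0,…,0)`, `D' = (0,…,0,1)`. -/
theorem poissonLap_dominating_pair_add (s γ : ℝ) (hs : 0 < s) (hγ0 : 0 ≤ γ) (hγ1 : γ ≤ 1) :
    (∀ (m : ℕ) (D : Fin m → ℝ) (D' : Fin (m + 1) → ℝ),
      (∀ j, D j ∈ Set.Icc (-1 : ℝ) 1) → (∀ j, D' j ∈ Set.Icc (-1 : ℝ) 1) →
      (∃ i : Fin (m + 1), ∀ j : Fin m, D j = D' (i.succAbove j)) →
      ∀ α : ℝ, 0 ≤ α →
        hsDiv α (poissonLap s γ D) (poissonLap s γ D') ≤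
          hsDiv α (lap 0 s)
            (ENNReal.ofReal (1 - γ) • lap 0 s + ENNReal.ofReal γ • lap 1 s)) ∧
    (∀ m : ℕ,
      poissonLap s γ (fun _ : Fin m => (0 : ℝ)) = lap 0 s ∧
      poissonLap s γ (Fin.snoc (fun _ : Fin m => (0 : ℝ)) 1) =
        ENNReal.ofReal (1 - γ) • lap 0 s + ENNReal.ofReal γ • lap 1 s) := by
  have h1 : 0 ≤ 1 - γ := sub_nonneg.2 hγ1
  have hfin := fun μ => isFiniteMeasure_lap μ hs
  refine ⟨fun m D D' _ hD' ⟨i, hi⟩ α hα => ?_, fun m => ⟨?_, ?_⟩⟩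
  · refine ciSup_le fun ⟨E, hE⟩ => ?_
    have hw : ∀ S : Finset (Fin m), 0 ≤ γ ^ S.card * (1 - γ) ^ (m - S.card) :=
      fun S => by positivity
    have hP : (poissonLap s γ D E).toReal = ∑ S : Finset (Fin m),
        γ ^ S.card * (1 - γ) ^ (m - S.card) * (lap (∑ j ∈ S, D j) s).real E := by
      simp only [poissonLap, Measure.finsetSum_apply, Measure.smul_apply, smul_eq_mul]
      rw [ENNReal.toReal_sum fun S _ =>
        ENNReal.mul_ne_top ENNReal.ofReal_ne_top (measure_ne_top _ _)]
      refine Finset.sum_congr rfl fun S _ => ?_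
      simp [ENNReal.toReal_ofReal (hw S), measureReal_def]
    have hQ : (poissonLap s γ D' E).toReal = ∑ S : Finset (Fin m),
        γ ^ S.card * (1 - γ) ^ (m - S.card) * ((1 - γ) * (lap (∑ j ∈ S, D j) s).real E +
          γ * (lap (∑ j ∈ S, D j + D' i) s).real E) := by
      have hne : ∀ c μ, (ENNReal.ofReal c * lap μ s E) ≠ ∞ := fun c μ =>
        ENNReal.mul_ne_top ENNReal.ofReal_ne_top (measure_ne_top _ _)
      simp only [poissonLap_succAbove s hγ0 hγ1 i hi, Measure.finsetSum_apply,
        Measure.smul_apply, Measure.add_apply, smul_eq_mul]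
      rw [ENNReal.toReal_sum fun S _ =>
        ENNReal.mul_ne_top ENNReal.ofReal_ne_top (ENNReal.add_ne_top.2 ⟨hne _ _, hne _ _⟩)]
      refine Finset.sum_congr rfl fun S _ => ?_
      simp [ENNReal.toReal_ofReal (hw S), measureReal_def, ENNReal.toReal_add (hne _ _) (hne _ _),
        ENNReal.toReal_ofReal hγ0, ENNReal.toReal_ofReal h1]
    rw [hP, hQ, Finset.mul_sum, ← Finset.sum_sub_distrib]
    refine (Finset.sum_le_sum fun S _ => ?_).trans_eq
      (by rw [← Finset.sum_mul, sum_poisson_weights γ m, one_mul])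
    rw [mul_left_comm, ← mul_sub]
    exact mul_le_mul_of_nonneg_left
      (lap_sub_mixture_le_hsDiv hs hγ0 hγ1 hα _ (abs_le.2 (hD' i)) hE) (hw S)
  · simp only [poissonLap, Finset.sum_const_zero]
    rw [← Finset.sum_smul, sum_ofReal_poisson_weights hγ0 hγ1, one_smul]
  · rw [poissonLap_succAbove s hγ0 hγ1 (Fin.last m) (D := fun _ => 0) (by simp)]
    simp only [Finset.sum_const_zero, Fin.snoc_last, zero_add]
    rw [← Finset.sum_smul, sum_ofReal_poisson_weights hγ0 hγ1, one_smul]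
end
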